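/- Let {X_n, n≥1} be a φ-mixing sequence of random variables with E X_i = 0 and |X_i| ≤ d < ∞ almost surely for i = 1, 2, …. Let 0 < β < 1, m = ⌈n^β⌉ (the integer part of n^β), and Δ_2 = Σ_{i=1}^n E X_i^2. Then for any ε > 0 and n ≥ 2, P(|Σ_{i=1}^n X_i| > ε) ≤ 2e C_1 exp{−ε² / (2 C_2 (2Δ_2 + n^β d ε))}, where C_1 = exp{2e n^{1−β} φ(m)}, C_2 = 4[1 + 4 Σ_{i=1}^{2m} φ^{1/2}(i)], and e is the base of the natural logarithm. -/

import Mathlib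

open MeasureTheory Filter Set

/-- The σ-algebra generated by the random variables `X i` for `i ∈ S`. -/
noncomputable def sigmaGen {Ω : Type*} (X : ℕ → Ω → ℝ) (S : Set ℕ) : MeasurableSpace Ω :=
  ⨆ i ∈ S, MeasurableSpace.comap (X i) inferInstance

/-- The φ-mixing coefficients of the sequence `X` with respect to the measure `μ`:
`φ(n) = sup_{k ≥ 1} sup { |P(B|A) - P(B)| : A ∈ σ(X_i, 1 ≤ i ≤ k), P(A) > 0,
B ∈ σ(X_i, i ≥ k + n) }`. -/
noncomputable def phiCoef {Ω : Type*} [MeasurableSpace Ω] (X : ℕ → Ω → ℝ)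
    (μ : Measure Ω) (n : ℕ) : ℝ :=
  sSup {r : ℝ | ∃ k : ℕ, 1 ≤ k ∧ ∃ A B : Set Ω,
    MeasurableSet[sigmaGen X {i | 1 ≤ i ∧ i ≤ k}] A ∧
    MeasurableSet[sigmaGen X {i | k + n ≤ i}] B ∧
    0 < μ A ∧
    r = |(μ (A ∩ B)).toReal / (μ A).toReal - (μ B).toReal|}

/-- The empirical distribution function `F_n(x) = n⁻¹ ∑_{i=1}^n I(X_i ≤ x)`. -/
noncomputable def empDF {Ω : Type*} (X : ℕ → Ω → ℝ) (n : ℕ) (ω : Ω) (x : ℝ) : ℝ :=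
  (n : ℝ)⁻¹ * ∑ i ∈ Finset.Icc 1 n, (if X i ω ≤ x then (1 : ℝ) else 0)

/-- The `p`-th quantile `F⁻¹(p) = inf {x : F(x) ≥ p}` of a distribution function `F`. -/
noncomputable def quantile (F : ℝ → ℝ) (p : ℝ) : ℝ :=
  sInf {x : ℝ | p ≤ F x}

/-- The sample `p`-th quantile `ξ_{p,n} = F_n⁻¹(p) = inf {x : F_n(x) ≥ p}`. -/
noncomputable def sampleQuantile {Ω : Type*} (X : ℕ → Ω → ℝ) (n : ℕ) (ω : Ω) (p : ℝ) : ℝ :=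
  sInf {x : ℝ | p ≤ empDF X n ω x}

/-- The events of `m₂` are `φ`-mixing with respect to those of `m₁`: conditioning on an event of
`m₁` changes the probability of an event of `m₂` by at most `φ`. -/
def PhiBound {Ω : Type*} [MeasurableSpace Ω] (μ : Measure Ω) (m₁ m₂ : MeasurableSpace Ω)
    (φ : ENNReal) : Prop :=
  ∀ A B : Set Ω, MeasurableSet[m₁] A → MeasurableSet[m₂] B →
    μ (A ∩ B) ≤ (μ B + φ) * μ A ∧ μ B * μ A ≤ μ (A ∩ B) + φ * μ A

namespace PhiBound

variable {Ω : Type*} {m₁ m₂ : MeasurableSpace Ω} [mΩ : MeasurableSpace Ω] {μ : Measure Ω}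
  {φ : ENNReal}

lemma mono {φ ψ : ENNReal} (h : PhiBound μ m₁ m₂ φ) (hφψ : φ ≤ ψ) : PhiBound μ m₁ m₂ ψ :=
  fun A B hA hB => ⟨(h A B hA hB).1.trans (by gcongr), (h A B hA hB).2.trans (by gcongr)⟩

lemma setLIntegral_le (h : PhiBound μ m₁ m₂ φ) (hm₁ : m₁ ≤ mΩ) {B : Set Ω}
    (hB : MeasurableSet[m₂] B) {f : Ω → ENNReal} (hf : Measurable[m₁] f) :
    ∫⁻ ω in B, f ω ∂μ ≤ (μ B + φ) * ∫⁻ ω, f ω ∂μ := by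
  have hle : (μ.restrict B).trim hm₁ ≤ (μ B + φ) • μ.trim hm₁ := by
    refine Measure.le_iff.2 fun A hA => ?_
    rw [Measure.smul_apply, trim_measurableSet_eq hm₁ hA, trim_measurableSet_eq hm₁ hA,
      Measure.restrict_apply (hm₁ _ hA)]
    exact (h A B hA hB).1
  rw [← lintegral_trim hm₁ hf, ← lintegral_trim hm₁ hf]
  refine (lintegral_mono' hle le_rfl).trans ?_
  rw [lintegral_smul_measure, smul_eq_mul]

lemma measure_mul_lintegral_le (h : PhiBound μ m₁ m₂ φ) (hm₁ : m₁ ≤ mΩ) {B : Set Ω}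
    (hB : MeasurableSet[m₂] B) {f : Ω → ENNReal} (hf : Measurable[m₁] f) :
    μ B * ∫⁻ ω, f ω ∂μ ≤ ∫⁻ ω in B, f ω ∂μ + φ * ∫⁻ ω, f ω ∂μ := by
  have hle : μ B • μ.trim hm₁ ≤ (μ.restrict B).trim hm₁ + φ • μ.trim hm₁ := by
    refine Measure.le_iff.2 fun A hA => ?_
    rw [Measure.add_apply, Measure.smul_apply, Measure.smul_apply, trim_measurableSet_eq hm₁ hA,
      trim_measurableSet_eq hm₁ hA, Measure.restrict_apply (hm₁ _ hA)]
    exact (h A B hA hB).2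
  rw [← lintegral_trim hm₁ hf, ← lintegral_trim (μ := μ.restrict B) hm₁ hf]
  have := lintegral_mono' hle (le_refl f)
  rwa [lintegral_add_measure, lintegral_smul_measure, lintegral_smul_measure, smul_eq_mul,
    smul_eq_mul] at this

end PhiBound

lemma ofReal_eq_lintegral_indicator (a : ℝ) :
    ENNReal.ofReal a = ∫⁻ t in Ioi (0 : ℝ), (Iic a).indicator 1 t := by
  rw [lintegral_indicator_one measurableSet_Iic, Measure.restrict_apply measurableSet_Iic,
    Set.inter_comm, Ioi_inter_Iic, Real.volume_Ioc, sub_zero]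

lemma ofReal_min_eq_lintegral_indicator (a b : ℝ) :
    ENNReal.ofReal (min a b) =
      ∫⁻ t in Ioi (0 : ℝ), (Iic a).indicator 1 t * (Iic b).indicator 1 t := by
  rw [ofReal_eq_lintegral_indicator]
  congr 1 with t
  by_cases h₁ : t ≤ a <;> by_cases h₂ : t ≤ b <;> simp [indicator, h₁, h₂]

lemma measurable_indicator_Iic {α : Type*} [MeasurableSpace α] {f : α → ℝ} {g : α → ℝ}
    (hf : Measurable f) (hg : Measurable g) :
    Measurable fun x => (Iic (f x)).indicator (1 : ℝ → ENNReal) (g x) := by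
  have : (fun x => (Iic (f x)).indicator (1 : ℝ → ENNReal) (g x)) =
      {x | g x ≤ f x}.indicator 1 := by
    ext x; simp [indicator]
  rw [this]
  exact measurable_one.indicator (measurableSet_le hg hf)

section Truncation

variable {Ω : Type*} [mΩ : MeasurableSpace Ω] {μ : Measure Ω} [SFinite μ]

lemma lintegral_mul_ofReal {u : Ω → ENNReal} {T : Ω → ℝ} (hu : Measurable u) (hT : Measurable T) :
    ∫⁻ ω, u ω * ENNReal.ofReal (T ω) ∂μ =
      ∫⁻ t in Ioi (0 : ℝ), ∫⁻ ω, u ω * (Iic (T ω)).indicator 1 t ∂μ := by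
  rw [lintegral_lintegral_swap]
  · refine lintegral_congr fun ω => ?_
    rw [lintegral_const_mul _ (measurable_one.indicator measurableSet_Iic),
      ofReal_eq_lintegral_indicator]
  · exact ((hu.comp measurable_snd).mul
      (measurable_indicator_Iic (hT.comp measurable_snd) measurable_fst)).aemeasurable

lemma lintegral_mul_ofReal_min {u : Ω → ENNReal} {v T : Ω → ℝ} (hu : Measurable u)
    (hv : Measurable v) (hT : Measurable T) :
    ∫⁻ ω, u ω * ENNReal.ofReal (min (v ω) (T ω)) ∂μ =
      ∫⁻ t in Ioi (0 : ℝ), ∫⁻ ω in {ω | t ≤ v ω}, u ω * (Iic (T ω)).indicator 1 t ∂μ := by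
  have h : ∀ t : ℝ, ∫⁻ ω in {ω | t ≤ v ω}, u ω * (Iic (T ω)).indicator 1 t ∂μ =
      ∫⁻ ω, u ω * ((Iic (v ω)).indicator 1 t * (Iic (T ω)).indicator 1 t) ∂μ := fun t => by
    rw [← lintegral_indicator (measurableSet_le measurable_const hv)]
    refine lintegral_congr fun ω => ?_
    by_cases h : t ≤ v ω <;> simp [indicator, h]
  simp_rw [h]
  rw [lintegral_lintegral_swap]
  · refine lintegral_congr fun ω => ?_
    rw [lintegral_const_mul, ofReal_min_eq_lintegral_indicator]
    exact (measurable_one.indicator measurableSet_Iic).mul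
      (measurable_one.indicator measurableSet_Iic)
  · exact ((hu.comp measurable_snd).mul
      ((measurable_indicator_Iic (hv.comp measurable_snd) measurable_fst).mul
      (measurable_indicator_Iic (hT.comp measurable_snd) measurable_fst))).aemeasurable

lemma lintegral_lintegral_mul_ofReal_min {u : Ω → ENNReal} {v T : Ω → ℝ} (hu : Measurable u)
    (hv : Measurable v) (hT : Measurable T) :
    ∫⁻ ω, ∫⁻ ω', u ω * ENNReal.ofReal (min (v ω') (T ω)) ∂μ ∂μ =
      ∫⁻ t in Ioi (0 : ℝ), μ {ω | t ≤ v ω} * ∫⁻ ω, u ω * (Iic (T ω)).indicator 1 t ∂μ := by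
  have h : ∀ t : ℝ, μ {ω | t ≤ v ω} * ∫⁻ ω, u ω * (Iic (T ω)).indicator 1 t ∂μ =
      ∫⁻ ω, ∫⁻ ω', u ω * ((Iic (v ω')).indicator 1 t * (Iic (T ω)).indicator 1 t) ∂μ ∂μ :=
    fun t => by
    have h₁ : μ {ω | t ≤ v ω} = ∫⁻ ω', (Iic (v ω')).indicator 1 t ∂μ := by
      rw [← lintegral_indicator_one (measurableSet_le measurable_const hv)]
      exact lintegral_congr fun ω => by simp [indicator]
    have h₂ := measurable_indicator_Iic (g := fun _ : Ω => t) hv measurable_const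
    have h₃ : Measurable fun ω => u ω * (Iic (T ω)).indicator 1 t :=
      hu.mul (measurable_indicator_Iic hT measurable_const)
    rw [h₁, ← lintegral_const_mul _ h₃]
    refine lintegral_congr fun ω => ?_
    rw [← lintegral_mul_const _ h₂]
    exact lintegral_congr fun ω' => by ring
  simp_rw [h]
  symm
  rw [lintegral_lintegral_swap]
  · refine lintegral_congr fun ω => ?_
    rw [lintegral_lintegral_swap]
    · refine lintegral_congr fun ω' => ?_
      rw [lintegral_const_mul, ofReal_min_eq_lintegral_indicator]
      exact (measurable_one.indicator measurableSet_Iic).mul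
        (measurable_one.indicator measurableSet_Iic)
    · exact (measurable_const.mul
        ((measurable_indicator_Iic (hv.comp measurable_snd) measurable_fst).mul
        (measurable_indicator_Iic measurable_const measurable_fst))).aemeasurable
  · refine Measurable.aemeasurable (Measurable.lintegral_prod_right'
      (f := fun p : (ℝ × Ω) × Ω => u p.1.2 * ((Iic (v p.2)).indicator 1 p.1.1 *
        (Iic (T p.1.2)).indicator 1 p.1.1)) ?_)
    exact (hu.comp (by fun_prop)).mul
      ((measurable_indicator_Iic (hv.comp measurable_snd) (by fun_prop)).mul
      (measurable_indicator_Iic (hT.comp (by fun_prop)) (by fun_prop)))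

end Truncation

namespace PhiBound

variable {Ω : Type*} {m₁ m₂ : MeasurableSpace Ω} [mΩ : MeasurableSpace Ω] {μ : Measure Ω}
  [SFinite μ] {φ : ENNReal}

lemma measurable_mul_indicator {u : Ω → ENNReal} {T : Ω → ℝ} (hu : Measurable u)
    (hT : Measurable T) :
    Measurable fun t : ℝ => ∫⁻ ω, u ω * (Iic (T ω)).indicator 1 t ∂μ := by
  have h : Measurable fun p : ℝ × Ω => u p.2 * (Iic (T p.2)).indicator 1 p.1 :=
    (hu.comp measurable_snd).mul
      (measurable_indicator_Iic (hT.comp measurable_snd) measurable_fst)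
  exact h.lintegral_prod_right'

lemma lintegral_mul_min_le (h : PhiBound μ m₁ m₂ φ) (hm₁ : m₁ ≤ mΩ) (hm₂ : m₂ ≤ mΩ)
    {u : Ω → ENNReal} {v T : Ω → ℝ} (hu : Measurable[m₁] u) (hv : Measurable[m₂] v)
    (hT : Measurable[m₁] T) :
    ∫⁻ ω, u ω * ENNReal.ofReal (min (v ω) (T ω)) ∂μ ≤
      ∫⁻ ω, ∫⁻ ω', u ω * ENNReal.ofReal (min (v ω') (T ω)) ∂μ ∂μ +
        φ * ∫⁻ ω, u ω * ENNReal.ofReal (T ω) ∂μ := by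
  have hu' := hu.mono hm₁ le_rfl
  have hv' := hv.mono hm₂ le_rfl
  have hT' := hT.mono hm₁ le_rfl
  have hF := measurable_mul_indicator (μ := μ) hu' hT'
  rw [lintegral_mul_ofReal_min hu' hv' hT', lintegral_lintegral_mul_ofReal_min hu' hv' hT',
    lintegral_mul_ofReal hu' hT', ← lintegral_const_mul _ hF,
    ← lintegral_add_right _ (hF.const_mul _)]
  refine lintegral_mono fun t => ?_
  rw [← add_mul]
  exact h.setLIntegral_le hm₁ (hv measurableSet_Ici)
    (hu.mul (@measurable_indicator_Iic _ m₁ _ _ hT measurable_const))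

lemma lintegral_lintegral_mul_min_le (h : PhiBound μ m₁ m₂ φ) (hm₁ : m₁ ≤ mΩ) (hm₂ : m₂ ≤ mΩ)
    {u : Ω → ENNReal} {v T : Ω → ℝ} (hu : Measurable[m₁] u) (hv : Measurable[m₂] v)
    (hT : Measurable[m₁] T) :
    ∫⁻ ω, ∫⁻ ω', u ω * ENNReal.ofReal (min (v ω') (T ω)) ∂μ ∂μ ≤
      ∫⁻ ω, u ω * ENNReal.ofReal (min (v ω) (T ω)) ∂μ +
        φ * ∫⁻ ω, u ω * ENNReal.ofReal (T ω) ∂μ := by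
  have hu' := hu.mono hm₁ le_rfl
  have hv' := hv.mono hm₂ le_rfl
  have hT' := hT.mono hm₁ le_rfl
  have hF := measurable_mul_indicator (μ := μ) hu' hT'
  rw [lintegral_mul_ofReal_min hu' hv' hT', lintegral_lintegral_mul_ofReal_min hu' hv' hT',
    lintegral_mul_ofReal hu' hT', ← lintegral_const_mul _ hF,
    ← lintegral_add_right _ (hF.const_mul _)]
  refine lintegral_mono fun t => ?_
  exact h.measure_mul_lintegral_le hm₁
    (hv measurableSet_Ici)
    (hu.mul (@measurable_indicator_Iic _ m₁ _ _ hT measurable_const))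

end PhiBound

namespace PhiBound

variable {Ω : Type*} {m₁ m₂ : MeasurableSpace Ω} [mΩ : MeasurableSpace Ω] {μ : Measure Ω}
  [IsProbabilityMeasure μ]

lemma integral_mul_le {φ : ℝ} (hφ : 0 ≤ φ) (h : PhiBound μ m₁ m₂ (ENNReal.ofReal φ))
    (hm₁ : m₁ ≤ mΩ) (hm₂ : m₂ ≤ mΩ) {u v : Ω → ℝ} {M : ℝ} (hu : Measurable[m₁] u)
    (hv : Measurable[m₂] v) (hu₀ : ∀ ω, 0 ≤ u ω) (hui : Integrable u μ)
    (hv₀ : ∀ ω, 0 ≤ v ω) (hvM : ∀ ω, v ω ≤ M) :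
    ∫ ω, u ω * v ω ∂μ ≤ (∫ ω, u ω ∂μ) * (∫ ω, v ω ∂μ + φ * M) := by
  have hM : 0 ≤ M := by
    obtain ⟨ω⟩ : Nonempty Ω := nonempty_of_isProbabilityMeasure μ
    exact (hv₀ ω).trans (hvM ω)
  have hvi : Integrable v μ := Integrable.of_bound
    (hv.mono hm₂ le_rfl).aestronglyMeasurable M (ae_of_all _ fun ω => by
      rw [Real.norm_of_nonneg (hv₀ ω)]; exact hvM ω)
  have huvi : Integrable (fun ω => u ω * v ω) μ :=
    hui.mul_bdd (c := M) (hv.mono hm₂ le_rfl).aestronglyMeasurable (ae_of_all _ fun ω => by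
      rw [Real.norm_of_nonneg (hv₀ ω)]; exact hvM ω)
  have hIu : 0 ≤ ∫ ω, u ω ∂μ := integral_nonneg fun ω => hu₀ ω
  have hIv : 0 ≤ ∫ ω, v ω ∂μ := integral_nonneg fun ω => hv₀ ω
  have key := h.lintegral_mul_min_le hm₁ hm₂ (u := fun ω => ENNReal.ofReal (u ω)) (v := v)
    (T := fun _ => M) hu.ennreal_ofReal hv measurable_const
  simp_rw [min_eq_left (hvM _)] at key
  rw [lintegral_mul_const _ (hu.mono hm₁ le_rfl).ennreal_ofReal] at key
  simp_rw [lintegral_const_mul _ (hv.mono hm₂ le_rfl).ennreal_ofReal] at key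
  rw [lintegral_mul_const _ (hu.mono hm₁ le_rfl).ennreal_ofReal] at key
  simp_rw [← ENNReal.ofReal_mul (hu₀ _)] at key
  rw [← ofReal_integral_eq_lintegral_ofReal huvi
      (ae_of_all _ fun ω => mul_nonneg (hu₀ ω) (hv₀ ω)),
    ← ofReal_integral_eq_lintegral_ofReal hui (ae_of_all _ hu₀),
    ← ofReal_integral_eq_lintegral_ofReal hvi (ae_of_all _ hv₀),
    ← ENNReal.ofReal_mul hIu, ← ENNReal.ofReal_mul hIu, ← ENNReal.ofReal_mul hφ,
    ← ENNReal.ofReal_add (by positivity) (by positivity),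
    ENNReal.ofReal_le_ofReal_iff (by positivity)] at key
  linarith

lemma abs_covariance_le_of_nonneg {φ c D : ℝ} (hφ : 0 ≤ φ) (hc : 0 < c)
    (h : PhiBound μ m₁ m₂ (ENNReal.ofReal φ))
    (hm₁ : m₁ ≤ mΩ) (hm₂ : m₂ ≤ mΩ) {ξ η : Ω → ℝ} (hξ : Measurable[m₁] ξ)
    (hη : Measurable[m₂] η) (hξ₀ : ∀ ω, 0 ≤ ξ ω) (hξD : ∀ ω, ξ ω ≤ D)
    (hη₀ : ∀ ω, 0 ≤ η ω) (hηD : ∀ ω, η ω ≤ D) :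
    |∫ ω, ξ ω * η ω ∂μ - (∫ ω, ξ ω ∂μ) * ∫ ω, η ω ∂μ| ≤
      φ * c * ∫ ω, ξ ω ^ 2 ∂μ + (4 * c)⁻¹ * ∫ ω, η ω ^ 2 ∂μ := by
  have hξ' := hξ.mono hm₁ le_rfl
  have hη' := hη.mono hm₂ le_rfl
  have hbdd : ∀ {f : Ω → ℝ} {K : ℝ}, Measurable f → (∀ ω, 0 ≤ f ω) → (∀ ω, f ω ≤ K) →
      Integrable f μ := fun hf h₀ hK => Integrable.of_bound hf.aestronglyMeasurable _
        (ae_of_all _ fun ω => by rw [Real.norm_of_nonneg (h₀ ω)]; exact hK ω)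
  have iξ := hbdd hξ' hξ₀ hξD
  have iη := hbdd hη' hη₀ hηD
  have iξη : Integrable (fun ω => ξ ω * η ω) μ :=
    hbdd (K := D * D) (hξ'.mul hη') (fun ω => mul_nonneg (hξ₀ ω) (hη₀ ω))
      (fun ω => mul_le_mul (hξD ω) (hηD ω) (hη₀ ω) ((hξ₀ ω).trans (hξD ω)))
  have iξ₂ : Integrable (fun ω => ξ ω ^ 2) μ :=
    hbdd (K := D ^ 2) (hξ'.pow_const 2) (fun ω => sq_nonneg _)
      (fun ω => pow_le_pow_left₀ (hξ₀ ω) (hξD ω) 2)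
  have iη₂ : Integrable (fun ω => η ω ^ 2) μ :=
    hbdd (K := D ^ 2) (hη'.pow_const 2) (fun ω => sq_nonneg _)
      (fun ω => pow_le_pow_left₀ (hη₀ ω) (hηD ω) 2)
  have hIξ : 0 ≤ ∫ ω, ξ ω ∂μ := integral_nonneg fun ω => hξ₀ ω
  have hIη : 0 ≤ ∫ ω, η ω ∂μ := integral_nonneg fun ω => hη₀ ω
  have hIξ₂ : 0 ≤ ∫ ω, ξ ω ^ 2 ∂μ := integral_nonneg fun ω => sq_nonneg _
  have hIη₂ : 0 ≤ ∫ ω, η ω ^ 2 ∂μ := integral_nonneg fun ω => sq_nonneg _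
  have hIξη : 0 ≤ ∫ ω, ξ ω * η ω ∂μ := integral_nonneg fun ω => mul_nonneg (hξ₀ ω) (hη₀ ω)
  have hpt : ∀ x y : ℝ, 0 ≤ x → 0 ≤ y → ENNReal.ofReal x * ENNReal.ofReal y ≤
      ENNReal.ofReal x * ENNReal.ofReal (min y (c * x)) +
        ENNReal.ofReal ((4 * c)⁻¹ * y ^ 2) := fun x y hx hy => by
    rw [← ENNReal.ofReal_mul hx, ← ENNReal.ofReal_mul hx,
      ← ENNReal.ofReal_add (by positivity) (by positivity)]
    refine ENNReal.ofReal_le_ofReal ?_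
    rcases le_total y (c * x) with hle | hle
    · rw [min_eq_left hle]
      have : 0 ≤ (4 * c)⁻¹ * y ^ 2 := by positivity
      linarith
    · rw [min_eq_right hle, ← sub_nonneg]
      have : x * (c * x) + (4 * c)⁻¹ * y ^ 2 - x * y = (4 * c)⁻¹ * (y - 2 * c * x) ^ 2 := by
        field_simp; ring
      rw [this]; positivity
  have e₁ : ENNReal.ofReal (∫ ω, ξ ω * η ω ∂μ) =
      ∫⁻ ω, ENNReal.ofReal (ξ ω) * ENNReal.ofReal (η ω) ∂μ := by
    rw [ofReal_integral_eq_lintegral_ofReal iξη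
      (ae_of_all _ fun ω => mul_nonneg (hξ₀ ω) (hη₀ ω))]
    exact lintegral_congr fun ω => ENNReal.ofReal_mul (hξ₀ ω)
  have e₂ : ENNReal.ofReal ((∫ ω, ξ ω ∂μ) * ∫ ω, η ω ∂μ) =
      ∫⁻ ω, ∫⁻ ω', ENNReal.ofReal (ξ ω) * ENNReal.ofReal (η ω') ∂μ ∂μ := by
    simp_rw [lintegral_const_mul _ hη'.ennreal_ofReal]
    rw [lintegral_mul_const _ hξ'.ennreal_ofReal, ENNReal.ofReal_mul hIξ,
      ofReal_integral_eq_lintegral_ofReal iξ (ae_of_all _ hξ₀),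
      ofReal_integral_eq_lintegral_ofReal iη (ae_of_all _ hη₀)]
  have e₃ : ENNReal.ofReal (φ * c * ∫ ω, ξ ω ^ 2 ∂μ) =
      ENNReal.ofReal φ * ∫⁻ ω, ENNReal.ofReal (ξ ω) * ENNReal.ofReal (c * ξ ω) ∂μ := by
    rw [mul_assoc, ENNReal.ofReal_mul hφ, ← integral_const_mul,
      ofReal_integral_eq_lintegral_ofReal (iξ₂.const_mul c)
        (ae_of_all _ fun ω => mul_nonneg hc.le (sq_nonneg _))]
    congr 1
    refine lintegral_congr fun ω => ?_
    rw [← ENNReal.ofReal_mul (hξ₀ ω)]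
    congr 1; ring
  have e₄ : ENNReal.ofReal ((4 * c)⁻¹ * ∫ ω, η ω ^ 2 ∂μ) =
      ∫⁻ ω, ENNReal.ofReal ((4 * c)⁻¹ * η ω ^ 2) ∂μ := by
    rw [← integral_const_mul, ofReal_integral_eq_lintegral_ofReal (iη₂.const_mul _)
        (ae_of_all _ fun ω => by positivity)]
  have hmeas₄ : Measurable fun ω => ENNReal.ofReal ((4 * c)⁻¹ * η ω ^ 2) :=
    ((hη'.pow_const 2).const_mul _).ennreal_ofReal
  have hup := h.lintegral_mul_min_le hm₁ hm₂ (u := fun ω => ENNReal.ofReal (ξ ω)) (v := η)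
    (T := fun ω => c * ξ ω) hξ.ennreal_ofReal hη (hξ.const_mul c)
  have hlow := h.lintegral_lintegral_mul_min_le hm₁ hm₂ (u := fun ω => ENNReal.ofReal (ξ ω))
    (v := η) (T := fun ω => c * ξ ω) hξ.ennreal_ofReal hη (hξ.const_mul c)
  have hmin : ∀ ω ω', ENNReal.ofReal (ξ ω) * ENNReal.ofReal (min (η ω') (c * ξ ω)) ≤
      ENNReal.ofReal (ξ ω) * ENNReal.ofReal (η ω') := fun ω ω' => by
    gcongr; exact min_le_left _ _
  rw [abs_sub_le_iff, sub_le_iff_le_add, sub_le_iff_le_add]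
  constructor
  · rw [← ENNReal.ofReal_le_ofReal_iff (by positivity),
      ENNReal.ofReal_add (by positivity) (by positivity),
      ENNReal.ofReal_add (by positivity) (by positivity), e₁, e₂, e₃, e₄]
    calc ∫⁻ ω, ENNReal.ofReal (ξ ω) * ENNReal.ofReal (η ω) ∂μ
        ≤ ∫⁻ ω, (ENNReal.ofReal (ξ ω) * ENNReal.ofReal (min (η ω) (c * ξ ω)) +
            ENNReal.ofReal ((4 * c)⁻¹ * η ω ^ 2)) ∂μ :=
          lintegral_mono fun ω => hpt _ _ (hξ₀ ω) (hη₀ ω)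
      _ = ∫⁻ ω, ENNReal.ofReal (ξ ω) * ENNReal.ofReal (min (η ω) (c * ξ ω)) ∂μ +
            ∫⁻ ω, ENNReal.ofReal ((4 * c)⁻¹ * η ω ^ 2) ∂μ := lintegral_add_right _ hmeas₄
      _ ≤ _ := by
          refine (add_le_add_left hup _).trans ?_
          have : ∫⁻ ω, ∫⁻ ω', ENNReal.ofReal (ξ ω) *
              ENNReal.ofReal (min (η ω') (c * ξ ω)) ∂μ ∂μ ≤
              ∫⁻ ω, ∫⁻ ω', ENNReal.ofReal (ξ ω) * ENNReal.ofReal (η ω') ∂μ ∂μ :=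
            lintegral_mono fun ω => lintegral_mono fun ω' => hmin ω ω'
          rw [add_comm (_ + _) (∫⁻ ω, ∫⁻ ω', _ ∂μ ∂μ), ← add_assoc]
          gcongr
  · rw [← ENNReal.ofReal_le_ofReal_iff (by positivity),
      ENNReal.ofReal_add (by positivity) (by positivity),
      ENNReal.ofReal_add (by positivity) (by positivity), e₁, e₂, e₃, e₄]
    calc ∫⁻ ω, ∫⁻ ω', ENNReal.ofReal (ξ ω) * ENNReal.ofReal (η ω') ∂μ ∂μ
        ≤ ∫⁻ ω, ∫⁻ ω', (ENNReal.ofReal (ξ ω) * ENNReal.ofReal (min (η ω') (c * ξ ω)) +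
            ENNReal.ofReal ((4 * c)⁻¹ * η ω' ^ 2)) ∂μ ∂μ :=
          lintegral_mono fun ω => lintegral_mono fun ω' => hpt _ _ (hξ₀ ω) (hη₀ ω')
      _ = ∫⁻ ω, ∫⁻ ω', ENNReal.ofReal (ξ ω) * ENNReal.ofReal (min (η ω') (c * ξ ω)) ∂μ ∂μ +
            ∫⁻ ω, ENNReal.ofReal ((4 * c)⁻¹ * η ω ^ 2) ∂μ := by
          simp_rw [lintegral_add_right _ hmeas₄]
          rw [lintegral_add_right _ measurable_const, lintegral_const, measure_univ, mul_one]
      _ ≤ _ := by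
          refine (add_le_add_left hlow _).trans ?_
          have : ∫⁻ ω, ENNReal.ofReal (ξ ω) * ENNReal.ofReal (min (η ω) (c * ξ ω)) ∂μ ≤
              ∫⁻ ω, ENNReal.ofReal (ξ ω) * ENNReal.ofReal (η ω) ∂μ :=
            lintegral_mono fun ω => hmin ω ω
          rw [add_comm (_ + _) (∫⁻ ω, ENNReal.ofReal (ξ ω) * ENNReal.ofReal (η ω) ∂μ),
            ← add_assoc]
          gcongr

lemma abs_covariance_le_add {φ c D : ℝ} (hφ : 0 ≤ φ) (hc : 0 < c)
    (h : PhiBound μ m₁ m₂ (ENNReal.ofReal φ))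
    (hm₁ : m₁ ≤ mΩ) (hm₂ : m₂ ≤ mΩ) {ξ η : Ω → ℝ} (hξ : Measurable[m₁] ξ)
    (hη : Measurable[m₂] η) (hξD : ∀ ω, |ξ ω| ≤ D) (hηD : ∀ ω, |η ω| ≤ D) :
    |∫ ω, ξ ω * η ω ∂μ - (∫ ω, ξ ω ∂μ) * ∫ ω, η ω ∂μ| ≤
      2 * (φ * c * ∫ ω, ξ ω ^ 2 ∂μ + (4 * c)⁻¹ * ∫ ω, η ω ^ 2 ∂μ) := by
  have bound : ∀ {f : Ω → ℝ} (K : ℝ), Measurable f → (∀ ω, |f ω| ≤ K) → Integrable f μ :=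
    fun K hf hK => Integrable.of_bound hf.aestronglyMeasurable K (ae_of_all _ hK)
  have hpos : ∀ (f : Ω → ℝ), (∀ ω, |f ω| ≤ D) → ∀ ω, max (f ω) 0 ≤ D := fun f hf ω =>
    max_le ((le_abs_self _).trans (hf ω)) ((abs_nonneg _).trans (hf ω))
  have hneg : ∀ (f : Ω → ℝ), (∀ ω, |f ω| ≤ D) → ∀ ω, max (-f ω) 0 ≤ D := fun f hf ω =>
    max_le ((neg_le_abs _).trans (hf ω)) ((abs_nonneg _).trans (hf ω))
  have hξ₁ : Measurable[m₁] fun ω => max (ξ ω) 0 := hξ.max measurable_const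
  have hξ₂ : Measurable[m₁] fun ω => max (-ξ ω) 0 := hξ.neg.max measurable_const
  have hη₁ : Measurable[m₂] fun ω => max (η ω) 0 := hη.max measurable_const
  have hη₂ : Measurable[m₂] fun ω => max (-η ω) 0 := hη.neg.max measurable_const
  have habs : ∀ {x : ℝ}, max x 0 ≤ D → |max x 0| ≤ D := fun hx => by
    rwa [abs_of_nonneg (le_max_right _ _)]
  have hD : ∀ {x y : ℝ}, |x| ≤ D → |y| ≤ D → |x * y| ≤ D * D := fun hx hy => by
    rw [abs_mul]
    exact mul_le_mul hx hy (abs_nonneg _) ((abs_nonneg _).trans hx)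
  have hdecomp : ∀ x : ℝ, x = max x 0 - max (-x) 0 := fun x => by
    rcases le_total x 0 with hx | hx
    · rw [max_eq_right hx, max_eq_left (by linarith)]; ring
    · rw [max_eq_left hx, max_eq_right (by linarith)]; ring
  have hsq : ∀ x : ℝ, x ^ 2 = max x 0 ^ 2 + max (-x) 0 ^ 2 := fun x => by
    rcases le_total x 0 with hx | hx
    · rw [max_eq_right hx, max_eq_left (by linarith)]; ring
    · rw [max_eq_left hx, max_eq_right (by linarith)]; ring
  have iξ₁ := bound D (hξ₁.mono hm₁ le_rfl) fun ω => habs (hpos ξ hξD ω)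
  have iξ₂ := bound D (hξ₂.mono hm₁ le_rfl) fun ω => habs (hneg ξ hξD ω)
  have iη₁ := bound D (hη₁.mono hm₂ le_rfl) fun ω => habs (hpos η hηD ω)
  have iη₂ := bound D (hη₂.mono hm₂ le_rfl) fun ω => habs (hneg η hηD ω)
  have iprod : ∀ {f g : Ω → ℝ}, Measurable f → Measurable g → (∀ ω, |f ω| ≤ D) →
      (∀ ω, |g ω| ≤ D) → Integrable (fun ω => f ω * g ω) μ := fun hf hg hf' hg' =>
    bound (D * D) (hf.mul hg) fun ω => hD (hf' ω) (hg' ω)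
  have i₁₁ := iprod (hξ₁.mono hm₁ le_rfl) (hη₁.mono hm₂ le_rfl)
    (fun ω => habs (hpos ξ hξD ω)) (fun ω => habs (hpos η hηD ω))
  have i₁₂ := iprod (hξ₁.mono hm₁ le_rfl) (hη₂.mono hm₂ le_rfl)
    (fun ω => habs (hpos ξ hξD ω)) (fun ω => habs (hneg η hηD ω))
  have i₂₁ := iprod (hξ₂.mono hm₁ le_rfl) (hη₁.mono hm₂ le_rfl)
    (fun ω => habs (hneg ξ hξD ω)) (fun ω => habs (hpos η hηD ω))
  have i₂₂ := iprod (hξ₂.mono hm₁ le_rfl) (hη₂.mono hm₂ le_rfl)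
    (fun ω => habs (hneg ξ hξD ω)) (fun ω => habs (hneg η hηD ω))
  have isq : ∀ {f : Ω → ℝ}, Measurable f → (∀ ω, |f ω| ≤ D) →
      Integrable (fun ω => f ω ^ 2) μ := fun hf hf' => by
    simp_rw [sq]; exact iprod hf hf hf' hf'
  have c₁₁ := abs_covariance_le_of_nonneg hφ hc h hm₁ hm₂ hξ₁ hη₁
    (fun ω => le_max_right _ _) (hpos ξ hξD) (fun ω => le_max_right _ _) (hpos η hηD)
  have c₁₂ := abs_covariance_le_of_nonneg hφ hc h hm₁ hm₂ hξ₁ hη₂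
    (fun ω => le_max_right _ _) (hpos ξ hξD) (fun ω => le_max_right _ _) (hneg η hηD)
  have c₂₁ := abs_covariance_le_of_nonneg hφ hc h hm₁ hm₂ hξ₂ hη₁
    (fun ω => le_max_right _ _) (hneg ξ hξD) (fun ω => le_max_right _ _) (hpos η hηD)
  have c₂₂ := abs_covariance_le_of_nonneg hφ hc h hm₁ hm₂ hξ₂ hη₂
    (fun ω => le_max_right _ _) (hneg ξ hξD) (fun ω => le_max_right _ _) (hneg η hηD)
  have eξ : ∫ ω, ξ ω ∂μ = ∫ ω, max (ξ ω) 0 ∂μ - ∫ ω, max (-ξ ω) 0 ∂μ := by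
    rw [← integral_sub iξ₁ iξ₂]; exact integral_congr_ae (ae_of_all _ fun ω => hdecomp _)
  have eη : ∫ ω, η ω ∂μ = ∫ ω, max (η ω) 0 ∂μ - ∫ ω, max (-η ω) 0 ∂μ := by
    rw [← integral_sub iη₁ iη₂]; exact integral_congr_ae (ae_of_all _ fun ω => hdecomp _)
  have eξ₂ : ∫ ω, ξ ω ^ 2 ∂μ = ∫ ω, max (ξ ω) 0 ^ 2 ∂μ + ∫ ω, max (-ξ ω) 0 ^ 2 ∂μ := by
    rw [← integral_add (isq (hξ₁.mono hm₁ le_rfl) fun ω => habs (hpos ξ hξD ω))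
      (isq (hξ₂.mono hm₁ le_rfl) fun ω => habs (hneg ξ hξD ω))]
    exact integral_congr_ae (ae_of_all _ fun ω => hsq _)
  have eη₂ : ∫ ω, η ω ^ 2 ∂μ = ∫ ω, max (η ω) 0 ^ 2 ∂μ + ∫ ω, max (-η ω) 0 ^ 2 ∂μ := by
    rw [← integral_add (isq (hη₁.mono hm₂ le_rfl) fun ω => habs (hpos η hηD ω))
      (isq (hη₂.mono hm₂ le_rfl) fun ω => habs (hneg η hηD ω))]
    exact integral_congr_ae (ae_of_all _ fun ω => hsq _)
  have eξη : ∫ ω, ξ ω * η ω ∂μ = ∫ ω, max (ξ ω) 0 * max (η ω) 0 ∂μ -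
      ∫ ω, max (ξ ω) 0 * max (-η ω) 0 ∂μ - (∫ ω, max (-ξ ω) 0 * max (η ω) 0 ∂μ -
      ∫ ω, max (-ξ ω) 0 * max (-η ω) 0 ∂μ) := by
    have hsub := integral_sub (i₁₁.sub i₁₂) (i₂₁.sub i₂₂)
    simp only [Pi.sub_apply] at hsub
    rw [← integral_sub i₁₁ i₁₂, ← integral_sub i₂₁ i₂₂, ← hsub]
    refine integral_congr_ae (ae_of_all _ fun ω => ?_)
    have h₁ := hdecomp (ξ ω)
    have h₂ := hdecomp (η ω)
    calc ξ ω * η ω = (max (ξ ω) 0 - max (-ξ ω) 0) * (max (η ω) 0 - max (-η ω) 0) := by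
          rw [← h₁, ← h₂]
      _ = _ := by ring
  rw [abs_le] at c₁₁ c₁₂ c₂₁ c₂₂
  rw [eξη, eξ, eη, eξ₂, eη₂, abs_le]
  constructor <;> nlinarith [c₁₁.1, c₁₁.2, c₁₂.1, c₁₂.2, c₂₁.1, c₂₁.2, c₂₂.1, c₂₂.2]

lemma abs_covariance_le {φ D : ℝ} (hφ : 0 ≤ φ) (h : PhiBound μ m₁ m₂ (ENNReal.ofReal φ))
    (hm₁ : m₁ ≤ mΩ) (hm₂ : m₂ ≤ mΩ) {ξ η : Ω → ℝ} (hξ : Measurable[m₁] ξ)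
    (hη : Measurable[m₂] η) (hξD : ∀ ω, |ξ ω| ≤ D) (hηD : ∀ ω, |η ω| ≤ D) :
    |∫ ω, ξ ω * η ω ∂μ - (∫ ω, ξ ω ∂μ) * ∫ ω, η ω ∂μ| ≤
      √φ * (∫ ω, ξ ω ^ 2 ∂μ + ∫ ω, η ω ^ 2 ∂μ) := by
  have key : ∀ δ : ℝ, 0 < δ → |∫ ω, ξ ω * η ω ∂μ - (∫ ω, ξ ω ∂μ) * ∫ ω, η ω ∂μ| ≤
      √(φ + δ) * (∫ ω, ξ ω ^ 2 ∂μ + ∫ ω, η ω ^ 2 ∂μ) := fun δ hδ => by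
    have hs : 0 < √(φ + δ) := Real.sqrt_pos.2 (by linarith)
    have hsq : √(φ + δ) ^ 2 = φ + δ := Real.sq_sqrt (by linarith)
    refine (abs_covariance_le_add (φ := φ + δ) (c := (2 * √(φ + δ))⁻¹) (by linarith)
      (by positivity) (h.mono (ENNReal.ofReal_le_ofReal (by linarith))) hm₁ hm₂ hξ hη hξD
      hηD).trans_eq ?_
    nth_rewrite 1 [← hsq]
    field_simp
    ring
  have hcont : Tendsto (fun δ : ℝ => √(φ + δ) * (∫ ω, ξ ω ^ 2 ∂μ + ∫ ω, η ω ^ 2 ∂μ))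
      (nhdsWithin 0 (Ioi 0)) (nhds (√(φ + 0) * (∫ ω, ξ ω ^ 2 ∂μ + ∫ ω, η ω ^ 2 ∂μ))) :=
    tendsto_nhdsWithin_of_tendsto_nhds (Continuous.tendsto (by fun_prop) 0)
  rw [add_zero] at hcont
  exact ge_of_tendsto hcont (eventually_nhdsWithin_of_forall key)

end PhiBound

section PhiCoef

variable {Ω : Type*} {X : ℕ → Ω → ℝ}

lemma comap_le_sigmaGen {i : ℕ} {S : Set ℕ} (hi : i ∈ S) :
    MeasurableSpace.comap (X i) inferInstance ≤ sigmaGen X S :=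
  le_iSup₂_of_le (f := fun i _ => MeasurableSpace.comap (X i) inferInstance) i hi le_rfl

variable [mΩ : MeasurableSpace Ω] {μ : Measure Ω}

lemma sigmaGen_le (hX : ∀ i, Measurable (X i)) (S : Set ℕ) : sigmaGen X S ≤ mΩ :=
  iSup₂_le fun i _ => (hX i).comap_le

lemma phiCoef_nonneg (n : ℕ) : 0 ≤ phiCoef X μ n :=
  Real.sSup_nonneg fun _ ⟨_, _, _, _, _, _, _, hr⟩ => hr ▸ abs_nonneg _

lemma phiBound_phiCoef [IsProbabilityMeasure μ] {k : ℕ} (hk : 1 ≤ k) (n : ℕ) :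
    PhiBound μ (sigmaGen X {i | 1 ≤ i ∧ i ≤ k}) (sigmaGen X {i | k + n ≤ i})
      (ENNReal.ofReal (phiCoef X μ n)) := by
  intro A B hA hB
  rcases eq_zero_or_pos (μ A) with h₀ | h₀
  · simp [h₀, measure_mono_null inter_subset_left h₀]
  have hle : |μ.real (A ∩ B) / μ.real A - μ.real B| ≤ phiCoef X μ n := by
    refine le_csSup ⟨1, ?_⟩ ⟨k, hk, A, B, hA, hB, h₀, rfl⟩
    rintro r ⟨k, -, A, B, -, -, -, rfl⟩
    have h₁ : (μ (A ∩ B)).toReal / (μ A).toReal ≤ 1 :=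
      div_le_one_of_le₀ (ENNReal.toReal_mono (measure_ne_top _ _)
        (measure_mono inter_subset_left)) ENNReal.toReal_nonneg
    have h₂ : 0 ≤ (μ (A ∩ B)).toReal / (μ A).toReal := by positivity
    have h₃ : (μ B).toReal ≤ 1 := measureReal_le_one
    have h₄ : 0 ≤ (μ B).toReal := ENNReal.toReal_nonneg
    rw [abs_le]
    constructor <;> linarith
  have hpos : 0 < μ.real A := ENNReal.toReal_pos h₀.ne' (measure_ne_top _ _)
  rw [abs_le, neg_le_sub_iff_le_add, sub_le_iff_le_add, div_le_iff₀ hpos,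
    ← sub_le_iff_le_add, le_div_iff₀ hpos] at hle
  have hφ := phiCoef_nonneg (μ := μ) (X := X) n
  rw [← ofReal_measureReal (μ := μ) (s := A), ← ofReal_measureReal (μ := μ) (s := B),
    ← ofReal_measureReal (μ := μ) (s := A ∩ B), ← ENNReal.ofReal_add (by positivity) hφ,
    ← ENNReal.ofReal_mul (by positivity), ← ENNReal.ofReal_mul (by positivity),
    ← ENNReal.ofReal_mul (by positivity), ← ENNReal.ofReal_add (by positivity) (by positivity)]
  exact ⟨ENNReal.ofReal_le_ofReal (by linarith), ENNReal.ofReal_le_ofReal (by linarith)⟩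

end PhiCoef

lemma sum_range_mul_pairs {M : Type*} [AddCommMonoid M] (f : ℕ → M) (m K : ℕ) :
    ∑ i ∈ Finset.range (2 * m * K), f i =
      ∑ j ∈ Finset.range K, (∑ l ∈ Finset.range m, f (2 * m * j + 0 + l) +
        ∑ l ∈ Finset.range m, f (2 * m * j + m + l)) := by
  induction K with
  | zero => simp
  | succ K ih =>
    rw [Finset.sum_range_succ, ← ih, show 2 * m * (K + 1) = 2 * m * K + m + m by ring,
      Finset.sum_range_add, Finset.sum_range_add, add_zero, add_assoc]

lemma sum_range_comp_sub_add_sub_le {w : ℕ → ℝ} (hw : ∀ k, 0 ≤ w k) {l m N : ℕ} (hl : l < m)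
    (hN : m ≤ N) :
    ∑ l' ∈ Finset.range m, w ((l - l') + (l' - l)) ≤ w 0 + 2 * ∑ k ∈ Finset.Icc 1 N, w k := by
  have hsum : ∀ p ≤ N, ∑ k ∈ Finset.range p, w (k + 1) ≤ ∑ k ∈ Finset.Icc 1 N, w k :=
    fun p hp => by
    rw [Finset.range_eq_Ico, Finset.sum_Ico_add' w 0 p 1]
    refine Finset.sum_le_sum_of_subset_of_nonneg (fun k hk => ?_) fun k _ _ => hw k
    simp only [Finset.mem_Ico, Finset.mem_Icc] at hk ⊢
    omega
  obtain ⟨p, rfl⟩ : ∃ p, m = l + (p + 1) := ⟨m - l - 1, by omega⟩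
  rw [Finset.sum_range_add, Finset.sum_range_succ']
  have h₁ : ∑ l' ∈ Finset.range l, w ((l - l') + (l' - l)) =
      ∑ k ∈ Finset.range l, w (k + 1) := by
    rw [← Finset.sum_range_reflect]
    refine Finset.sum_congr rfl fun k hk => ?_
    rw [Finset.mem_range] at hk
    congr 1; omega
  have h₂ : ∑ k ∈ Finset.range p, w ((l - (l + (k + 1))) + ((l + (k + 1)) - l)) =
      ∑ k ∈ Finset.range p, w (k + 1) :=
    Finset.sum_congr rfl fun k _ => by congr 1; omega
  rw [h₁, h₂, show (l - (l + 0)) + (l + 0 - l) = 0 by omega]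
  have h₃ := hsum l (by omega)
  have h₄ := hsum p (by omega)
  linarith

lemma abs_sum_le_mul {Ω : Type*} {Z : ℕ → Ω → ℝ} {d : ℝ} (hZd : ∀ i ω, |Z i ω| ≤ d) (m s : ℕ) (ω : Ω) :
    |∑ l ∈ Finset.range m, Z (s + l + 1) ω| ≤ m * d :=
  (Finset.abs_sum_le_sum_abs _ _).trans
    ((Finset.sum_le_sum fun l _ => hZd (s + l + 1) ω).trans_eq (by simp))

section Blocks

variable {Ω : Type*} [mΩ : MeasurableSpace Ω] {μ : Measure Ω} [IsProbabilityMeasure μ]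
  {X Z : ℕ → Ω → ℝ} {d : ℝ}

lemma integrable_of_abs_le {f : Ω → ℝ} {K : ℝ} (hf : Measurable f) (hK : ∀ ω, |f ω| ≤ K) :
    Integrable f μ :=
  Integrable.of_bound hf.aestronglyMeasurable K (ae_of_all _ hK)

lemma abs_integral_mul_le_sqrt_phiCoef (hX : ∀ i, Measurable (X i))
    (hZ : ∀ i, Measurable[MeasurableSpace.comap (X i) inferInstance] (Z i))
    (hZd : ∀ i ω, |Z i ω| ≤ d) (hZ₀ : ∀ i, ∫ ω, Z i ω ∂μ = 0) {i j : ℕ} (hi : 1 ≤ i)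
    (hij : i < j) :
    |∫ ω, Z i ω * Z j ω ∂μ| ≤
      √(phiCoef X μ (j - i)) * (∫ ω, Z i ω ^ 2 ∂μ + ∫ ω, Z j ω ^ 2 ∂μ) := by
  have hZi : Measurable[sigmaGen X {k | 1 ≤ k ∧ k ≤ i}] (Z i) :=
    (hZ i).mono (comap_le_sigmaGen ⟨hi, le_rfl⟩) le_rfl
  have hZj : Measurable[sigmaGen X {k | i + (j - i) ≤ k}] (Z j) :=
    (hZ j).mono (comap_le_sigmaGen (by simp; omega)) le_rfl
  have h := (phiBound_phiCoef (μ := μ) (X := X) hi (j - i)).abs_covariance_le (phiCoef_nonneg _)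
    (sigmaGen_le hX _) (sigmaGen_le hX _) hZi hZj (hZd i) (hZd j)
  rwa [hZ₀ i, zero_mul, sub_zero] at h

lemma integral_sq_sum_le (hX : ∀ i, Measurable (X i))
    (hZ : ∀ i, Measurable[MeasurableSpace.comap (X i) inferInstance] (Z i))
    (hZd : ∀ i ω, |Z i ω| ≤ d) (hZ₀ : ∀ i, ∫ ω, Z i ω ∂μ = 0) {m N : ℕ} (hN : m ≤ N) (s : ℕ) :
    ∫ ω, (∑ l ∈ Finset.range m, Z (s + l + 1) ω) ^ 2 ∂μ ≤
      (1 + 4 * ∑ i ∈ Finset.Icc 1 N, √(phiCoef X μ i)) *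
        ∑ l ∈ Finset.range m, ∫ ω, Z (s + l + 1) ω ^ 2 ∂μ := by
  have hZm : ∀ i, Measurable (Z i) := fun i => (hZ i).mono (hX i).comap_le le_rfl
  have hint : ∀ i j, Integrable (fun ω => Z i ω * Z j ω) μ := fun i j =>
    integrable_of_abs_le (K := d * d) ((hZm i).mul (hZm j)) fun ω => by
      rw [abs_mul]
      exact mul_le_mul (hZd i ω) (hZd j ω) (abs_nonneg _) ((abs_nonneg _).trans (hZd i ω))
  set w : ℕ → ℝ := fun k => if k = 0 then 1 / 2 else √(phiCoef X μ k) with hw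
  have hw₀ : ∀ k, 0 ≤ w k := fun k => by
    simp only [hw]; split_ifs <;> positivity
  have hw' : ∀ k, k ≠ 0 → w k = √(phiCoef X μ k) := fun k hk => if_neg hk
  set a : ℕ → ℝ := fun l => ∫ ω, Z (s + l + 1) ω ^ 2 ∂μ with ha
  have ha₀ : ∀ l, 0 ≤ a l := fun l => integral_nonneg fun ω => sq_nonneg _
  have hcov : ∀ l l', ∫ ω, Z (s + l + 1) ω * Z (s + l' + 1) ω ∂μ ≤
      w ((l - l') + (l' - l)) * (a l + a l') := fun l l' => by
    rcases lt_trichotomy l l' with h | h | h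
    · have := (le_abs_self _).trans (abs_integral_mul_le_sqrt_phiCoef hX hZ hZd hZ₀
        (i := s + l + 1) (j := s + l' + 1) (by omega) (by omega))
      rw [show s + l' + 1 - (s + l + 1) = (l - l') + (l' - l) by omega] at this
      rwa [hw' _ (by omega)]
    · subst h
      simp only [hw, ha, Nat.sub_self, add_zero, if_true]
      simp_rw [sq]
      linarith
    · have := (le_abs_self _).trans (abs_integral_mul_le_sqrt_phiCoef hX hZ hZd hZ₀
        (i := s + l' + 1) (j := s + l + 1) (by omega) (by omega))
      rw [show s + l + 1 - (s + l' + 1) = (l - l') + (l' - l) by omega] at this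
      simp_rw [mul_comm (Z (s + l + 1) _)]
      rwa [hw' _ (by omega), add_comm (a l)]
  have hwsum : ∑ k ∈ Finset.Icc 1 N, w k = ∑ k ∈ Finset.Icc 1 N, √(phiCoef X μ k) :=
    Finset.sum_congr rfl fun k hk => by
      rw [Finset.mem_Icc] at hk
      exact hw' k (by omega)
  calc ∫ ω, (∑ l ∈ Finset.range m, Z (s + l + 1) ω) ^ 2 ∂μ
      = ∑ l ∈ Finset.range m, ∑ l' ∈ Finset.range m,
          ∫ ω, Z (s + l + 1) ω * Z (s + l' + 1) ω ∂μ := by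
        simp_rw [sq, Finset.sum_mul_sum]
        rw [integral_finsetSum _ fun l _ => integrable_finsetSum _ fun l' _ => hint _ _]
        exact Finset.sum_congr rfl fun l _ => integral_finsetSum _ fun l' _ => hint _ _
    _ ≤ ∑ l ∈ Finset.range m, ∑ l' ∈ Finset.range m,
          w ((l - l') + (l' - l)) * (a l + a l') :=
        Finset.sum_le_sum fun l _ => Finset.sum_le_sum fun l' _ => hcov l l'
    _ = 2 * ∑ l ∈ Finset.range m, a l * ∑ l' ∈ Finset.range m, w ((l - l') + (l' - l)) := by
        simp_rw [mul_add, Finset.sum_add_distrib, two_mul, Finset.mul_sum]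
        congr 1
        · exact Finset.sum_congr rfl fun l _ => Finset.sum_congr rfl fun l' _ => mul_comm _ _
        · rw [Finset.sum_comm]
          exact Finset.sum_congr rfl fun l _ => Finset.sum_congr rfl fun l' _ => by
            rw [mul_comm, add_comm]
    _ ≤ 2 * ∑ l ∈ Finset.range m, a l * (w 0 + 2 * ∑ k ∈ Finset.Icc 1 N, w k) := by
        gcongr with l hl
        exact sum_range_comp_sub_add_sub_le hw₀ (Finset.mem_range.1 hl) hN
    _ = _ := by
        rw [← Finset.sum_mul, hwsum, show w 0 = 1 / 2 by simp [hw]]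
        ring

lemma integral_exp_mul_le {V : Ω → ℝ} {τ K : ℝ} (hV : Measurable V) (hVK : ∀ ω, |V ω| ≤ K)
    (hV₀ : ∫ ω, V ω ∂μ = 0) (hτ : |τ| * K ≤ 1) :
    ∫ ω, Real.exp (τ * V ω) ∂μ ≤ 1 + τ ^ 2 * ∫ ω, V ω ^ 2 ∂μ := by
  have hτV : ∀ ω, |τ * V ω| ≤ 1 := fun ω => by
    rw [abs_mul]
    exact (mul_le_mul_of_nonneg_left (hVK ω) (abs_nonneg τ)).trans hτ
  have hi : Integrable V μ := integrable_of_abs_le hV hVK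
  have hi₂ : Integrable (fun ω => V ω ^ 2) μ :=
    integrable_of_abs_le (K := K ^ 2) (hV.pow_const 2) fun ω => by
      rw [abs_pow]; exact pow_le_pow_left₀ (abs_nonneg _) (hVK ω) 2
  have hie : Integrable (fun ω => Real.exp (τ * V ω)) μ :=
    integrable_of_abs_le (K := Real.exp 1) (hV.const_mul τ).exp fun ω => by
      rw [abs_of_pos (Real.exp_pos _)]
      exact Real.exp_le_exp.2 ((le_abs_self _).trans (hτV ω))
  calc ∫ ω, Real.exp (τ * V ω) ∂μ ≤ ∫ ω, (1 + τ * V ω + τ ^ 2 * V ω ^ 2) ∂μ := by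
        refine integral_mono hie
          (((integrable_const 1).add (hi.const_mul τ)).add (hi₂.const_mul _)) fun ω => ?_
        have := (abs_le.1 (Real.abs_exp_sub_one_sub_id_le (hτV ω))).2
        simp only
        nlinarith
    _ = 1 + τ ^ 2 * ∫ ω, V ω ^ 2 ∂μ := by
        have hi₁ : Integrable (fun ω => 1 + τ * V ω) μ :=
          (integrable_const 1).add (hi.const_mul τ)
        rw [integral_add hi₁ (hi₂.const_mul _),
          integral_add (integrable_const 1) (hi.const_mul τ), integral_const_mul,
          integral_const_mul, hV₀]
        simp

lemma integral_exp_sum_blocks_le (hX : ∀ i, Measurable (X i))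
    (hZ : ∀ i, Measurable[MeasurableSpace.comap (X i) inferInstance] (Z i))
    (hZd : ∀ i ω, |Z i ω| ≤ d) (hZ₀ : ∀ i, ∫ ω, Z i ω ∂μ = 0) {m : ℕ} (hm : 1 ≤ m) (s : ℕ)
    {τ : ℝ} (hτ : |τ| * (m * d) ≤ 1) (K : ℕ) :
    ∫ ω, Real.exp (τ * ∑ j ∈ Finset.range (K + 1), ∑ l ∈ Finset.range m,
        Z (2 * m * j + s + l + 1) ω) ∂μ ≤
      Real.exp (K * (Real.exp 1 * phiCoef X μ m) + τ ^ 2 * ∑ j ∈ Finset.range (K + 1),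
        ∫ ω, (∑ l ∈ Finset.range m, Z (2 * m * j + s + l + 1) ω) ^ 2 ∂μ) := by
  have hZm : ∀ i, Measurable (Z i) := fun i => (hZ i).mono (hX i).comap_le le_rfl
  set V : ℕ → Ω → ℝ := fun j ω => ∑ l ∈ Finset.range m, Z (2 * m * j + s + l + 1) ω with hV
  have hVm : ∀ j, Measurable (V j) := fun j => Finset.measurable_sum _ fun l _ => hZm _
  have hVd : ∀ j ω, |V j ω| ≤ m * d := fun j ω => abs_sum_le_mul hZd m (2 * m * j + s) ω
  have hV₀ : ∀ j, ∫ ω, V j ω ∂μ = 0 := fun j => by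
    simp only [hV]
    rw [integral_finsetSum _ fun l _ => integrable_of_abs_le (hZm _) (hZd _)]
    simp [hZ₀]
  have hone : ∀ j, ∫ ω, Real.exp (τ * V j ω) ∂μ ≤ 1 + τ ^ 2 * ∫ ω, V j ω ^ 2 ∂μ := fun j =>
    integral_exp_mul_le (hVm j) (hVd j) (hV₀ j) hτ
  have hφ := phiCoef_nonneg (μ := μ) (X := X) m
  induction K with
  | zero =>
    simp only [zero_add, Finset.sum_range_one, Nat.cast_zero, zero_mul]
    refine (hone 0).trans ?_
    rw [add_comm]
    exact Real.add_one_le_exp _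
  | succ K ih =>
    set k := 2 * m * K + s + m with hk
    have hu : Measurable[sigmaGen X {i | 1 ≤ i ∧ i ≤ k}] fun ω =>
        Real.exp (τ * ∑ j ∈ Finset.range (K + 1), V j ω) := by
      refine (Measurable.const_mul ?_ τ).exp
      refine Finset.measurable_sum _ fun j hj => Finset.measurable_sum _ fun l hl => ?_
      refine (hZ _).mono (comap_le_sigmaGen ⟨by omega, ?_⟩) le_rfl
      rw [Finset.mem_range] at hj hl
      have : 2 * m * j ≤ 2 * m * K := Nat.mul_le_mul_left _ (by omega)
      omega
    have hv : Measurable[sigmaGen X {i | k + m ≤ i}] fun ω => Real.exp (τ * V (K + 1) ω) := by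
      refine (Measurable.const_mul ?_ τ).exp
      refine Finset.measurable_sum _ fun l hl => ?_
      refine (hZ _).mono (comap_le_sigmaGen ?_) le_rfl
      have : 2 * m * (K + 1) = 2 * m * K + m + m := by ring
      rw [mem_ofPred_eq]
      omega
    have hsum : ∀ ω, |∑ j ∈ Finset.range (K + 1), V j ω| ≤ (K + 1 : ℕ) * (m * d) := fun ω =>
      (Finset.abs_sum_le_sum_abs _ _).trans
        ((Finset.sum_le_sum fun j _ => hVd j ω).trans_eq (by simp))
    have hui : Integrable (fun ω => Real.exp (τ * ∑ j ∈ Finset.range (K + 1), V j ω)) μ :=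
      integrable_of_abs_le (K := Real.exp (|τ| * ((K + 1 : ℕ) * (m * d))))
        (hu.mono (sigmaGen_le hX _) le_rfl) fun ω => by
          rw [abs_of_pos (Real.exp_pos _)]
          refine Real.exp_le_exp.2 ((le_abs_self _).trans ?_)
          rw [abs_mul]
          exact mul_le_mul_of_nonneg_left (hsum ω) (abs_nonneg _)
    have hstep := (phiBound_phiCoef (μ := μ) (X := X) (k := k) (by omega) m).integral_mul_le
      hφ (sigmaGen_le hX _) (sigmaGen_le hX _) (M := Real.exp 1) hu hv
      (fun ω => (Real.exp_pos _).le) hui (fun ω => (Real.exp_pos _).le) fun ω => by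
        refine Real.exp_le_exp.2 ((le_abs_self _).trans ?_)
        rw [abs_mul]
        exact (mul_le_mul_of_nonneg_left (hVd _ ω) (abs_nonneg τ)).trans hτ
    have hfac : ∫ ω, Real.exp (τ * V (K + 1) ω) ∂μ + phiCoef X μ m * Real.exp 1 ≤
        Real.exp (Real.exp 1 * phiCoef X μ m + τ ^ 2 * ∫ ω, V (K + 1) ω ^ 2 ∂μ) := by
      have := Real.add_one_le_exp
        (Real.exp 1 * phiCoef X μ m + τ ^ 2 * ∫ ω, V (K + 1) ω ^ 2 ∂μ)
      linarith [hone (K + 1)]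
    calc ∫ ω, Real.exp (τ * ∑ j ∈ Finset.range (K + 1 + 1), V j ω) ∂μ
        = ∫ ω, Real.exp (τ * ∑ j ∈ Finset.range (K + 1), V j ω) *
            Real.exp (τ * V (K + 1) ω) ∂μ := by
          simp_rw [Finset.sum_range_succ _ (K + 1), mul_add, Real.exp_add]
      _ ≤ _ := hstep
      _ ≤ Real.exp (K * (Real.exp 1 * phiCoef X μ m) +
            τ ^ 2 * ∑ j ∈ Finset.range (K + 1), ∫ ω, V j ω ^ 2 ∂μ) *
          Real.exp (Real.exp 1 * phiCoef X μ m + τ ^ 2 * ∫ ω, V (K + 1) ω ^ 2 ∂μ) :=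
          mul_le_mul ih hfac (add_nonneg (integral_nonneg fun ω => (Real.exp_pos _).le)
            (mul_nonneg hφ (Real.exp_pos _).le)) (Real.exp_pos _).le
      _ = _ := by
          rw [← Real.exp_add, Finset.sum_range_succ _ (K + 1)]
          congr 1
          push_cast
          ring

lemma integral_exp_sum_le (hX : ∀ i, Measurable (X i))
    (hZ : ∀ i, Measurable[MeasurableSpace.comap (X i) inferInstance] (Z i))
    (hZd : ∀ i ω, |Z i ω| ≤ d) (hZ₀ : ∀ i, ∫ ω, Z i ω ∂μ = 0) {m : ℕ} (hm : 1 ≤ m)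
    {t : ℝ} (ht : |2 * t| * (m * d) ≤ 1) (K : ℕ) :
    ∫ ω, Real.exp (t * ∑ i ∈ Finset.range (2 * m * (K + 1)), Z (i + 1) ω) ∂μ ≤
      Real.exp (K * (Real.exp 1 * phiCoef X μ m) +
        t ^ 2 * (4 * (1 + 4 * ∑ i ∈ Finset.Icc 1 (2 * m), √(phiCoef X μ i))) *
          ∑ i ∈ Finset.range (2 * m * (K + 1)), ∫ ω, Z (i + 1) ω ^ 2 ∂μ) := by
  have hZm : ∀ i, Measurable (Z i) := fun i => (hZ i).mono (hX i).comap_le le_rfl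
  set R : ℝ := 1 + 4 * ∑ i ∈ Finset.Icc 1 (2 * m), √(phiCoef X μ i) with hR
  have hR₀ : 0 ≤ R := by positivity
  set a : ℕ → ℝ := fun i => ∫ ω, Z (i + 1) ω ^ 2 ∂μ with ha
  have ha₀ : ∀ i, 0 ≤ a i := fun i => integral_nonneg fun ω => sq_nonneg _
  set A : ℕ → Ω → ℝ := fun s ω =>
    ∑ j ∈ Finset.range (K + 1), ∑ l ∈ Finset.range m, Z (2 * m * j + s + l + 1) ω with hA
  set σ : ℕ → ℝ := fun s =>
    ∑ j ∈ Finset.range (K + 1), ∑ l ∈ Finset.range m, a (2 * m * j + s + l) with hσ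
  have hσ₀ : ∀ s, 0 ≤ σ s := fun s =>
    Finset.sum_nonneg fun j _ => Finset.sum_nonneg fun l _ => ha₀ _
  have hAm : ∀ s, Measurable (A s) := fun s =>
    Finset.measurable_sum _ fun j _ => Finset.measurable_sum _ fun l _ => hZm _
  have hAd : ∀ s ω, |A s ω| ≤ (K + 1 : ℕ) * (m * d) := fun s ω =>
    (Finset.abs_sum_le_sum_abs _ _).trans
      ((Finset.sum_le_sum fun j _ => abs_sum_le_mul hZd m (2 * m * j + s) ω).trans_eq (by simp))
  have hAe : ∀ s, Integrable (fun ω => Real.exp (2 * t * A s ω)) μ := fun s =>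
    integrable_of_abs_le (K := Real.exp (|2 * t| * ((K + 1 : ℕ) * (m * d))))
      ((hAm s).const_mul _).exp fun ω => by
        rw [abs_of_pos (Real.exp_pos _)]
        refine Real.exp_le_exp.2 ((le_abs_self _).trans ?_)
        rw [abs_mul]
        exact mul_le_mul_of_nonneg_left (hAd s ω) (abs_nonneg _)
  have hsumZ : ∀ ω, ∑ i ∈ Finset.range (2 * m * (K + 1)), Z (i + 1) ω = A 0 ω + A m ω :=
    fun ω => by
    rw [sum_range_mul_pairs (fun i => Z (i + 1) ω), Finset.sum_add_distrib]
  have hsuma : ∑ i ∈ Finset.range (2 * m * (K + 1)), a i = σ 0 + σ m := by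
    rw [sum_range_mul_pairs, Finset.sum_add_distrib]
  have hmgf : ∀ s, σ s ≤ σ 0 + σ m → ∫ ω, Real.exp (2 * t * A s ω) ∂μ ≤
      Real.exp (K * (Real.exp 1 * phiCoef X μ m) + t ^ 2 * (4 * R) * (σ 0 + σ m)) :=
    fun s hs => by
    refine (integral_exp_sum_blocks_le hX hZ hZd hZ₀ hm s ht K).trans (Real.exp_le_exp.2 ?_)
    have hvar : ∑ j ∈ Finset.range (K + 1),
        ∫ ω, (∑ l ∈ Finset.range m, Z (2 * m * j + s + l + 1) ω) ^ 2 ∂μ ≤ R * σ s := by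
      rw [hσ, Finset.mul_sum]
      exact Finset.sum_le_sum fun j _ =>
        integral_sq_sum_le hX hZ hZd hZ₀ (by omega : m ≤ 2 * m) (2 * m * j + s)
    have := mul_le_mul_of_nonneg_left
      (hvar.trans (mul_le_mul_of_nonneg_left hs hR₀)) (sq_nonneg (2 * t))
    linarith
  simp_rw [hsumZ, hsuma]
  calc ∫ ω, Real.exp (t * (A 0 ω + A m ω)) ∂μ
      ≤ ∫ ω, (1 / 2 * Real.exp (2 * t * A 0 ω) + 1 / 2 * Real.exp (2 * t * A m ω)) ∂μ := by
        refine integral_mono_of_nonneg (ae_of_all _ fun ω => (Real.exp_pos _).le)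
          (((hAe 0).const_mul _).add ((hAe m).const_mul _)) (ae_of_all _ fun ω => ?_)
        have h₁ : Real.exp (t * (A 0 ω + A m ω)) =
            Real.exp (t * A 0 ω) * Real.exp (t * A m ω) := by
          rw [← Real.exp_add, mul_add]
        have h₂ : ∀ x : ℝ, Real.exp (2 * t * x) = Real.exp (t * x) ^ 2 := fun x => by
          rw [← Real.exp_nat_mul]; congr 1; push_cast; ring
        simp only [h₁, h₂]
        nlinarith [sq_nonneg (Real.exp (t * A 0 ω) - Real.exp (t * A m ω))]
    _ = 1 / 2 * ∫ ω, Real.exp (2 * t * A 0 ω) ∂μ +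
          1 / 2 * ∫ ω, Real.exp (2 * t * A m ω) ∂μ := by
        rw [integral_add ((hAe 0).const_mul _) ((hAe m).const_mul _), integral_const_mul,
          integral_const_mul]
    _ ≤ _ := by
        linarith [hmgf 0 (by linarith [hσ₀ m]), hmgf m (by linarith [hσ₀ 0])]

lemma measureReal_le_abs_sum_le (hX : ∀ i, Measurable (X i))
    (hZ : ∀ i, Measurable[MeasurableSpace.comap (X i) inferInstance] (Z i))
    (hZd : ∀ i ω, |Z i ω| ≤ d) (hZ₀ : ∀ i, ∫ ω, Z i ω ∂μ = 0) {m : ℕ} (hm : 1 ≤ m)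
    {t : ℝ} (ht₀ : 0 ≤ t) (ht : 2 * t * (m * d) ≤ 1) (K : ℕ) (ε : ℝ) :
    μ.real {ω | ε ≤ |∑ i ∈ Finset.range (2 * m * (K + 1)), Z (i + 1) ω|} ≤
      2 * Real.exp (-t * ε + K * (Real.exp 1 * phiCoef X μ m) +
        t ^ 2 * (4 * (1 + 4 * ∑ i ∈ Finset.Icc 1 (2 * m), √(phiCoef X μ i))) *
          ∑ i ∈ Finset.range (2 * m * (K + 1)), ∫ ω, Z (i + 1) ω ^ 2 ∂μ) := by
  have hZm : ∀ i, Measurable (Z i) := fun i => (hZ i).mono (hX i).comap_le le_rfl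
  set S : Ω → ℝ := fun ω => ∑ i ∈ Finset.range (2 * m * (K + 1)), Z (i + 1) ω with hS
  have hSm : Measurable S := Finset.measurable_sum _ fun i _ => hZm _
  have hSd : ∀ ω, |S ω| ≤ (2 * m * (K + 1) : ℕ) * d := fun ω =>
    (Finset.abs_sum_le_sum_abs _ _).trans
      ((Finset.sum_le_sum fun i _ => hZd (i + 1) ω).trans_eq (by simp))
  have hSe : ∀ r : ℝ, Integrable (fun ω => Real.exp (r * S ω)) μ := fun r =>
    integrable_of_abs_le (K := Real.exp (|r| * ((2 * m * (K + 1) : ℕ) * d)))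
      (hSm.const_mul _).exp fun ω => by
        rw [abs_of_pos (Real.exp_pos _)]
        refine Real.exp_le_exp.2 ((le_abs_self _).trans ?_)
        rw [abs_mul]
        exact mul_le_mul_of_nonneg_left (hSd ω) (abs_nonneg _)
  have habs : |2 * t| = 2 * t := abs_of_nonneg (by positivity)
  have h₁ := ProbabilityTheory.measure_ge_le_exp_mul_mgf (μ := μ) (X := S) ε ht₀ (hSe t)
  have h₂ := ProbabilityTheory.measure_le_le_exp_mul_mgf (μ := μ) (X := S) (-ε)
    (neg_nonpos.2 ht₀) (hSe (-t))
  have h₃ := integral_exp_sum_le (μ := μ) hX hZ hZd hZ₀ hm (t := t) (by rwa [habs]) K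
  have h₄ := integral_exp_sum_le (μ := μ) hX hZ hZd hZ₀ hm (t := -t)
    (by rwa [mul_neg, abs_neg, habs]) K
  rw [neg_sq] at h₄
  rw [show -(-t) * -ε = -t * ε by ring] at h₂
  have hsub : {ω | ε ≤ |S ω|} ⊆ {ω | ε ≤ S ω} ∪ {ω | S ω ≤ -ε} := fun ω hω => by
    rcases le_abs.1 (show ε ≤ |S ω| from hω) with h | h
    · exact Or.inl h
    · exact Or.inr (le_neg_of_le_neg h)
  refine (measureReal_mono hsub).trans ((measureReal_union_le _ _).trans ?_)
  rw [add_assoc, Real.exp_add, two_mul]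
  exact add_le_add (h₁.trans (mul_le_mul_of_nonneg_left h₃ (Real.exp_pos _).le))
    (h₂.trans (mul_le_mul_of_nonneg_left h₄ (Real.exp_pos _).le))

end Blocks

lemma natCast_pred_div_two_mul_floor_rpow_le {n : ℕ} (hn : 1 ≤ n) {β : ℝ} (hβ : 0 ≤ β) :
    (((n - 1) / (2 * ⌊(n : ℝ) ^ β⌋₊) : ℕ) : ℝ) ≤ (n : ℝ) ^ (1 - β) := by
  have hn₁ : (1 : ℝ) ≤ n := by exact_mod_cast hn
  have hn₀ : (0 : ℝ) < n := by linarith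
  have hpow : 0 < (n : ℝ) ^ β := Real.rpow_pos_of_pos hn₀ β
  set m := ⌊(n : ℝ) ^ β⌋₊ with hm
  have hm₁ : 1 ≤ m := Nat.le_floor (by simpa using Real.one_le_rpow hn₁ hβ)
  have hm₁' : (1 : ℝ) ≤ m := by exact_mod_cast hm₁
  have hlt : (n : ℝ) ^ β < m + 1 := Nat.lt_floor_add_one _
  have hdiv : (((n - 1) / (2 * m) : ℕ) : ℝ) * (2 * m) ≤ n := by
    have : (n - 1) / (2 * m) * (2 * m) ≤ n := (Nat.div_mul_le_self _ _).trans (Nat.sub_le _ _)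
    exact_mod_cast this
  have hmul : (n : ℝ) ^ (1 - β) * (n : ℝ) ^ β = n := by
    rw [← Real.rpow_add hn₀, sub_add_cancel, Real.rpow_one]
  refine le_of_mul_le_mul_right (le_trans ?_ (hdiv.trans_eq hmul.symm)) hpow
  gcongr
  linarith

/-- **Lemma 3.1** (exponential inequality). Let `{X_n}` be a φ-mixing sequence with
`E X_i = 0`, `|X_i| ≤ d < ∞` a.s., `0 < β < 1`, `m = ⌊n^β⌋`, `Δ₂ = ∑_{i=1}^n E X_i²`.
Then for any `ε > 0` and `n ≥ 2`,
`P(|∑_{i=1}^n X_i| > ε) ≤ 2e C₁ exp{-ε² / (2 C₂ (2Δ₂ + n^β d ε))}`,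
where `C₁ = exp{2e n^{1-β} φ(m)}` and `C₂ = 4[1 + 4 ∑_{i=1}^{2m} φ^{1/2}(i)]`. -/
theorem bahadur_lem_3_1 {Ω : Type*} [MeasurableSpace Ω] (μ : Measure Ω)
    [IsProbabilityMeasure μ]
    (X : ℕ → Ω → ℝ) (hX : ∀ i, Measurable (X i))
    (hanti : Antitone (phiCoef X μ))
    (hmix : Tendsto (phiCoef X μ) atTop (nhds 0))
    (hint : ∀ i, 1 ≤ i → Integrable (X i) μ)
    (hmean : ∀ i, 1 ≤ i → ∫ ω, X i ω ∂μ = 0)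
    (d : ℝ) (hd : 0 < d) (hbound : ∀ i, 1 ≤ i → ∀ᵐ ω ∂μ, |X i ω| ≤ d)
    (β : ℝ) (hβ : 0 < β ∧ β < 1)
    (n : ℕ) (hn : 2 ≤ n)
    (m : ℕ) (hm : m = ⌊(n : ℝ) ^ β⌋₊)
    (Δ2 : ℝ) (hΔ2 : Δ2 = ∑ i ∈ Finset.Icc 1 n, ∫ ω, X i ω ^ 2 ∂μ)
    (C1 : ℝ) (hC1 : C1 = Real.exp (2 * Real.exp 1 * (n : ℝ) ^ (1 - β) * phiCoef X μ m))
    (C2 : ℝ) (hC2 : C2 = 4 * (1 + 4 * ∑ i ∈ Finset.Icc 1 (2 * m), Real.sqrt (phiCoef X μ i)))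
    (ε : ℝ) (hε : 0 < ε) :
    (μ {ω | ε < |∑ i ∈ Finset.Icc 1 n, X i ω|}).toReal ≤
      2 * Real.exp 1 * C1 *
        Real.exp (-ε ^ 2 / (2 * C2 * (2 * Δ2 + (n : ℝ) ^ β * d * ε))) := by
  have hn₁ : (1 : ℝ) ≤ n := by exact_mod_cast (by omega : 1 ≤ n)
  have hpow : 1 ≤ (n : ℝ) ^ β := Real.one_le_rpow hn₁ hβ.1.le
  have hm₁ : 1 ≤ m := hm ▸ Nat.le_floor (by simpa using hpow)
  have hmle : (m : ℝ) ≤ (n : ℝ) ^ β := hm ▸ Nat.floor_le (by linarith)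
  set K := (n - 1) / (2 * m) with hK
  have hKle : (K : ℝ) ≤ (n : ℝ) ^ (1 - β) := by
    rw [hK, hm]; exact natCast_pred_div_two_mul_floor_rpow_le (by omega) hβ.1.le
  have hnK : n ≤ 2 * m * (K + 1) := by
    have : n - 1 < 2 * m * (K + 1) := Nat.lt_mul_div_succ (n - 1) (b := 2 * m) (by omega)
    omega
  set Z : ℕ → Ω → ℝ := fun i ω =>
    if 1 ≤ i ∧ i ≤ n then max (-d) (min d (X i ω)) else 0 with hZdef
  have hZ : ∀ i, Measurable[MeasurableSpace.comap (X i) inferInstance] (Z i) := fun i => by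
    by_cases hi : 1 ≤ i ∧ i ≤ n
    · simp only [hZdef, if_pos hi]
      exact measurable_const.max (measurable_const.min (comap_measurable (X i)))
    · simp only [hZdef, if_neg hi]
      exact measurable_const
  have hZd : ∀ i ω, |Z i ω| ≤ d := fun i ω => by
    simp only [hZdef]
    split_ifs
    · exact abs_le.2 ⟨le_max_left _ _, max_le (by linarith) (min_le_left _ _)⟩
    · simpa using hd.le
  have hZX : ∀ i, 1 ≤ i → i ≤ n → Z i =ᵐ[μ] X i := fun i hi hin => by
    filter_upwards [hbound i hi] with ω hω
    simp only [hZdef, if_pos (And.intro hi hin)]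
    rw [abs_le] at hω
    rw [min_eq_right hω.2, max_eq_right hω.1]
  have hZout : ∀ i, n < i → ∀ ω, Z i ω = 0 := fun i hi ω => if_neg (by omega)
  have hZ₀ : ∀ i, ∫ ω, Z i ω ∂μ = 0 := fun i => by
    by_cases hi : 1 ≤ i ∧ i ≤ n
    · rw [integral_congr_ae (hZX i hi.1 hi.2), hmean i hi.1]
    · simp only [hZdef, if_neg hi, integral_zero]
  have hreindex : ∀ f : ℕ → ℝ, (∀ i, n < i → f i = 0) →
      ∑ i ∈ Finset.range (2 * m * (K + 1)), f (i + 1) = ∑ i ∈ Finset.Icc 1 n, f i :=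
    fun f hf => by
    rw [Finset.range_eq_Ico, Finset.sum_Ico_add' f 0 _ 1]
    refine (Finset.sum_subset (fun i hi => ?_) fun i hi' hi => hf i ?_).symm
    · simp only [Finset.mem_Icc, Finset.mem_Ico] at hi ⊢
      omega
    · rw [Finset.mem_Ico] at hi'
      rw [Finset.mem_Icc] at hi
      omega
  have hΔ : ∑ i ∈ Finset.range (2 * m * (K + 1)), ∫ ω, Z (i + 1) ω ^ 2 ∂μ = Δ2 := by
    rw [hreindex (fun i => ∫ ω, Z i ω ^ 2 ∂μ) fun i hi => by simp [hZout i hi], hΔ2]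
    refine Finset.sum_congr rfl fun i hi => integral_congr_ae ?_
    rw [Finset.mem_Icc] at hi
    filter_upwards [hZX i hi.1 hi.2] with ω hω
    rw [hω]
  have hΔ₀ : 0 ≤ Δ2 := hΔ2 ▸ Finset.sum_nonneg fun i _ => integral_nonneg fun ω => sq_nonneg _
  have hC₂ : 4 ≤ C2 := by
    have : 0 ≤ ∑ i ∈ Finset.Icc 1 (2 * m), √(phiCoef X μ i) := by positivity
    linarith
  set D := 2 * Δ2 + (n : ℝ) ^ β * d * ε with hD
  have hmD : m * d * ε ≤ D := by
    have : m * d * ε ≤ (n : ℝ) ^ β * d * ε := by gcongr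
    linarith
  have hD₀ : 0 < D := by positivity
  have hmono : μ.real {ω | ε < |∑ i ∈ Finset.Icc 1 n, X i ω|} ≤
      μ.real {ω | ε ≤ |∑ i ∈ Finset.range (2 * m * (K + 1)), Z (i + 1) ω|} := by
    refine ENNReal.toReal_mono (measure_ne_top _ _) (measure_mono_ae ?_)
    have hall : ∀ᵐ ω ∂μ, ∀ i ∈ Finset.Icc 1 n, Z i ω = X i ω :=
      (ae_ball_iff (Finset.Icc 1 n).countable_toSet).2 fun i hi => by
        have hi' := Finset.mem_Icc.1 hi
        exact hZX i hi'.1 hi'.2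
    filter_upwards [hall] with ω hω h
    change ε ≤ |∑ i ∈ Finset.range (2 * m * (K + 1)), Z (i + 1) ω|
    rw [hreindex (fun i => Z i ω) fun i hi => hZout i hi ω, Finset.sum_congr rfl hω]
    exact le_of_lt h
  set t := ε / (C2 * D) with ht
  have ht₀ : 0 ≤ t := by positivity
  have htm : 2 * t * (m * d) ≤ 1 := by
    rw [ht, show 2 * (ε / (C2 * D)) * (m * d) = 2 * (m * d * ε) / (C2 * D) by ring,
      div_le_one (by positivity)]
    nlinarith
  have key := hmono.trans
    (measureReal_le_abs_sum_le (μ := μ) hX hZ hZd hZ₀ hm₁ ht₀ htm K ε)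
  rw [hΔ, ← hC2] at key
  have hφ := phiCoef_nonneg (μ := μ) (X := X) m
  have hexp : -t * ε + K * (Real.exp 1 * phiCoef X μ m) + t ^ 2 * C2 * Δ2 ≤
      2 * Real.exp 1 * (n : ℝ) ^ (1 - β) * phiCoef X μ m + -ε ^ 2 / (2 * C2 * D) := by
    have h₁ : K * (Real.exp 1 * phiCoef X μ m) ≤
        2 * Real.exp 1 * (n : ℝ) ^ (1 - β) * phiCoef X μ m := by
      have := mul_le_mul_of_nonneg_right hKle (mul_nonneg (Real.exp_pos 1).le hφ)
      have h₀ : 0 ≤ (K : ℝ) * (Real.exp 1 * phiCoef X μ m) := by positivity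
      linarith
    have h₂ : t ^ 2 * C2 * Δ2 ≤ ε ^ 2 / (2 * C2 * D) := by
      have hle : t ^ 2 * C2 * Δ2 ≤ t ^ 2 * C2 * (D / 2) := by
        have : 0 ≤ (n : ℝ) ^ β * d * ε := by positivity
        gcongr
        linarith
      refine hle.trans_eq ?_
      rw [ht]; field_simp
    have h₃ : -t * ε = 2 * (-ε ^ 2 / (2 * C2 * D)) := by
      rw [ht]; field_simp
    have h₄ : -ε ^ 2 / (2 * C2 * D) = -(ε ^ 2 / (2 * C2 * D)) := neg_div _ _
    linarith
  refine key.trans ?_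
  rw [hC1, mul_assoc (2 * Real.exp 1), ← Real.exp_add]
  have he : 1 ≤ Real.exp 1 := Real.one_le_exp zero_le_one
  have := Real.exp_le_exp.2 hexp
  gcongr
  linarith
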